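/- arXiv:math/0306043 — 3 statements merged into one kernel-verified Lean document; each statement's English description precedes it below -/
import Mathlib

section
/- Let A be a semiprimary ring with Jacobson radical J. Then the (left) global dimension of A is finite if and only if there exists n > 0 such that Ext_A^n(A/J, A/J) = 0. -/
open CategoryTheory

noncomputable section

instance (A : Type) [Ring A] : HasExt.{1} (ModuleCat.{0} A) := by
  letI := HasDerivedCategory.standard (ModuleCat.{0} A)
  exact hasExt_of_hasDerivedCategory _

/-- The Jacobson radical of the ring `A`, as a two-sided ideal. -/
def jrad (A : Type) [Ring A] : TwoSidedIdeal A := TwoSidedIdeal.jacobson ⊥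

/-- `A/J` is a semisimple ring. -/
def SemisimpleModJ (A : Type) [Ring A] : Prop :=
  IsSemisimpleRing (jrad A).ringCon.Quotient

/-- The Jacobson radical satisfies `J ^ 3 = 0`. -/
def JCubeZero (A : Type) [Ring A] : Prop :=
  ∀ x y z : A, x ∈ jrad A → y ∈ jrad A → z ∈ jrad A → x * y * z = 0

/-- `A` is semiprimary: `A/J` is semisimple and the Jacobson radical `J` is nilpotent. -/
def IsSemiprimary (A : Type) [Ring A] : Prop :=
  SemisimpleModJ A ∧
    ∃ n : ℕ, ∀ x : Fin n → A, (∀ i, x i ∈ jrad A) → (List.ofFn x).prod = 0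

/-- `A/J` as a left `A`-module, an object of `ModuleCat A`. -/
def AmodJ (A : Type) [Ring A] : ModuleCat.{0} A :=
  ModuleCat.of A (A ⧸ (jrad A).asIdeal)

/-- The submodule `J·N`, for `J` the Jacobson radical of `A` and `N` a submodule of `M`. -/
def jSmul (A : Type) [Ring A] {M : Type} [AddCommGroup M] [Module A M]
    (N : Submodule A M) : Submodule A M :=
  Submodule.span A {y | ∃ x ∈ jrad A, ∃ m ∈ N, y = x • m}

/-- `M` has projective dimension at most `n`, characterized by vanishing of
`Ext^k(M, -)` for `k > n`. -/
def projDimLE (A : Type) [Ring A] (M : ModuleCat.{0} A) (n : ℕ) : Prop :=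
  ∀ (N : ModuleCat.{0} A) (k : ℕ), n < k → Subsingleton (Abelian.Ext M N k)

/-- The projective dimension of `M`, valued in `ℕ∞` (infinite if no bound exists). -/
def projDim (A : Type) [Ring A] (M : ModuleCat.{0} A) : ℕ∞ :=
  sInf {e : ℕ∞ | ∃ n : ℕ, e = n ∧ projDimLE A M n}

/-- `N` has injective dimension at most `n`, characterized by vanishing of
`Ext^k(-, N)` for `k > n`. -/
def injDimLE (A : Type) [Ring A] (N : ModuleCat.{0} A) (n : ℕ) : Prop :=
  ∀ (M : ModuleCat.{0} A) (k : ℕ), n < k → Subsingleton (Abelian.Ext M N k)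

/-- The injective dimension of `N`, valued in `ℕ∞`. -/
def injDim (A : Type) [Ring A] (N : ModuleCat.{0} A) : ℕ∞ :=
  sInf {e : ℕ∞ | ∃ n : ℕ, e = n ∧ injDimLE A N n}

/-- The (left) global dimension of `A`: the supremum of projective dimensions of
all left `A`-modules. -/
def globalDim (A : Type) [Ring A] : ℕ∞ :=
  ⨆ M : ModuleCat.{0} A, projDim A M

/-- `N` is the (first) syzygy of `M`: `N` is isomorphic to the kernel of a
projective cover `P → M` (a surjection from a projective module with superfluous
kernel, i.e. kernel contained in `J·P`). -/
def IsSyzygy (A : Type) [Ring A] (M N : ModuleCat.{0} A) : Prop :=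
  ∃ (P : ModuleCat.{0} A) (f : P →ₗ[A] M), Module.Projective A P ∧
    Function.Surjective f ∧ LinearMap.ker f ≤ jSmul A (⊤ : Submodule A P) ∧
    Nonempty (N ≃ₗ[A] LinearMap.ker f)

/-- `N` is the `n`-th syzygy `Ω^n M` of `M` in its minimal projective resolution. -/
def IsNthSyzygy (A : Type) [Ring A] : ℕ → ModuleCat.{0} A → ModuleCat.{0} A → Prop
  | 0, M, N => Nonempty (M ≃ₗ[A] N)
  | n + 1, M, N => ∃ K : ModuleCat.{0} A, IsNthSyzygy A n M K ∧ IsSyzygy A K N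

/-- `S` is (isomorphic to) a direct summand of the module `W`. -/
def IsDirectSummandOf (A : Type) [Ring A] (S W : ModuleCat.{0} A) : Prop :=
  ∃ U V : Submodule A W, IsCompl U V ∧ Nonempty (S ≃ₗ[A] U)

/-- The submodule `X` is a direct summand of the submodule `W` (inside a common
ambient module). -/
def IsSummandIn (A : Type) [Ring A] {P : Type} [AddCommGroup P] [Module A P]
    (X W : Submodule A P) : Prop :=
  X ≤ W ∧ ∃ C ≤ W, X ⊓ C = ⊥ ∧ X ⊔ C = W

/-- The module `N` (a submodule of an ambient module) has no simple direct summand. -/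
def NoSimpleSummand (A : Type) [Ring A] {P : Type} [AddCommGroup P] [Module A P]
    (N : Submodule A P) : Prop :=
  ¬ ∃ S : Submodule A P, IsSimpleModule A S ∧ IsSummandIn A S N

/-- The order relation on simple modules: `S ⪯ T` iff `S` is a direct summand of
some syzygy `Ω^m T`. -/
def Preceq (A : Type) [Ring A] (S T : ModuleCat.{0} A) : Prop :=
  ∃ (m : ℕ) (W : ModuleCat.{0} A), IsNthSyzygy A m T W ∧ IsDirectSummandOf A S W

/-- `Ext_A^n(S, S) = 0` for every simple `A`-module `S` and every `n ≥ m`. -/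
def ExtSelfVanishes (A : Type) [Ring A] (m : ℕ) : Prop :=
  ∀ S : ModuleCat.{0} A, IsSimpleModule A S →
    ∀ n : ℕ, m ≤ n → Subsingleton (Abelian.Ext S S n)

/-- The Yoneda ring `E = ⊕ₙ Ext^n(A/J, A/J)` is generated in finite degrees:
there is `s` such that every homogeneous element of degree `n > s` is a sum of
Yoneda products of homogeneous elements of positive degrees `< n`. -/
def YonedaGeneratedInFiniteDegrees (A : Type) [Ring A] : Prop :=
  ∃ s : ℕ, ∀ n : ℕ, s < n → ∀ e : Abelian.Ext (AmodJ A) (AmodJ A) n,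
    e ∈ AddSubgroup.closure {x : Abelian.Ext (AmodJ A) (AmodJ A) n |
      ∃ (i j : ℕ) (h : i + j = n) (_ : 0 < i) (_ : 0 < j)
        (a : Abelian.Ext (AmodJ A) (AmodJ A) i)
        (b : Abelian.Ext (AmodJ A) (AmodJ A) j), x = a.comp b h}

/-- The data of the canonical sequence `(M₀ = S, M₁, M₂, ...)` associated to a
simple module `S` over a ring with `J³ = 0`: for each `n`, `P n` is a projective
cover of `M n`, and its kernel (the syzygy `Ω M_n`) decomposes as
`M_{n+1} ⊕ Y_{n+1}`, where `Y_{n+1}` is a direct summand of `J²·P n` and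
`M_{n+1} ∩ J²·P n = J·M_{n+1}`. -/
structure AssocSeqData (A : Type) [Ring A] (S : ModuleCat.{0} A) where
  M : ℕ → ModuleCat.{0} A
  iso0 : Nonempty (M 0 ≃ₗ[A] S)
  P : ℕ → ModuleCat.{0} A
  proj : ∀ n, Module.Projective A (P n)
  π : ∀ n, P n →ₗ[A] M n
  surj : ∀ n, Function.Surjective (π n)
  cover : ∀ n, LinearMap.ker (π n) ≤ jSmul A (⊤ : Submodule A (P n))
  Msub : ∀ n, Submodule A (P n)
  Ysub : ∀ n, Submodule A (P n)
  isoM : ∀ n, Nonempty (M (n + 1) ≃ₗ[A] Msub n)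
  indep : ∀ n, Msub n ⊓ Ysub n = ⊥
  sup_eq : ∀ n, Msub n ⊔ Ysub n = LinearMap.ker (π n)
  Y_summand : ∀ n, IsSummandIn A (Ysub n) (jSmul A (jSmul A (⊤ : Submodule A (P n))))
  M_cap : ∀ n, Msub n ⊓ jSmul A (jSmul A (⊤ : Submodule A (P n))) = jSmul A (Msub n)

/-- The iterated Yoneda product `eₙ · ... · e₂ · e₁ · 1` of classes
`eᵢ ∈ Ext^1(S_{i-1}, S_i)`. -/
def extChain (A : Type) [Ring A] (S : ℕ → ModuleCat.{0} A)
    (e : ∀ i : ℕ, Abelian.Ext (S i) (S (i + 1)) 1) :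
    ∀ n : ℕ, Abelian.Ext (S 0) (S n) n
  | 0 => Abelian.Ext.mk₀ (𝟙 (S 0))
  | n + 1 => (extChain A S e n).comp (e n) rfl

/-- The iterated Yoneda product `eₙ · ... · e₁ · f` where `f ∈ Ext^0(S, A/J)` and
`eᵢ ∈ Ext^1(A/J, A/J)`. -/
def extChainFrom (A : Type) [Ring A] {S : ModuleCat.{0} A}
    (f : Abelian.Ext S (AmodJ A) 0)
    (e : ℕ → Abelian.Ext (AmodJ A) (AmodJ A) 1) :
    ∀ n : ℕ, Abelian.Ext S (AmodJ A) n
  | 0 => f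
  | n + 1 => (extChainFrom A f e n).comp (e n) rfl

namespace CategoryTheory.ShortComplex.ShortExact

open Abelian

universe w v u

variable {C : Type u} [Category.{v} C] [Abelian C] [HasExt.{w} C]
  {S : ShortComplex C} (hS : S.ShortExact) [Projective S.X₂] (Y : C)

include hS

/-- If `S.X₂` is projective, then `Ext¹(S.X₃, Y)` vanishes exactly when every morphism
`S.X₁ ⟶ Y` extends along `S.f`. -/
lemma subsingleton_ext_one_iff :
    Subsingleton (Ext S.X₃ Y 1) ↔ ∀ g : S.X₁ ⟶ Y, ∃ h : S.X₂ ⟶ Y, S.f ≫ h = g := by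
  refine ⟨fun _ g ↦ ?_, fun H ↦ subsingleton_of_forall_eq 0 fun x ↦ ?_⟩
  · obtain ⟨x, hx⟩ := Ext.contravariant_sequence_exact₁ hS Y (Ext.mk₀ g) (add_zero 1)
      (Subsingleton.elim _ _)
    obtain ⟨h, rfl⟩ := Ext.homEquiv₀.symm.surjective x
    exact ⟨h, Ext.homEquiv₀.symm.injective (by simpa using hx)⟩
  · obtain ⟨y, rfl⟩ := Ext.contravariant_sequence_exact₃ hS Y x
      (Ext.eq_zero_of_projective _) (add_zero 1)
    obtain ⟨g, rfl⟩ := Ext.homEquiv₀.symm.surjective y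
    obtain ⟨h, rfl⟩ := H g
    rw [Ext.homEquiv₀_symm_apply, ← Ext.mk₀_comp_mk₀, hS.extClass_comp_assoc]

/-- Dimension shifting for the vanishing of `Ext` in its first argument. -/
lemma subsingleton_ext_add_two_iff (n : ℕ) :
    Subsingleton (Ext S.X₃ Y (n + 2)) ↔ Subsingleton (Ext S.X₁ Y (n + 1)) := by
  have hn : 1 + (n + 1) = n + 2 := by lia
  refine ⟨fun _ ↦ subsingleton_of_forall_eq 0 fun x ↦ ?_,
    fun _ ↦ subsingleton_of_forall_eq 0 fun x ↦ ?_⟩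
  · obtain ⟨y, rfl⟩ := Ext.contravariant_sequence_exact₁ hS Y x hn (Subsingleton.elim _ _)
    rw [y.eq_zero_of_projective, Ext.comp_zero]
  · obtain ⟨y, rfl⟩ := Ext.contravariant_sequence_exact₃ hS Y x
      (Ext.eq_zero_of_projective _) hn
    rw [Subsingleton.elim y 0, Ext.comp_zero]

end CategoryTheory.ShortComplex.ShortExact

namespace CategoryTheory.Retract

open Abelian

universe w v u

variable {C : Type u} [Category.{v} C] [Abelian C] [HasExt.{w} C] {Y Z : C}

lemma subsingleton_ext (h : Retract Y Z) (X : C) (n : ℕ) [Subsingleton (Ext X Z n)] :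
    Subsingleton (Ext X Y n) := by
  refine subsingleton_of_forall_eq 0 fun x ↦ ?_
  rw [← x.comp_mk₀_id, ← h.retract, ← Ext.mk₀_comp_mk₀,
    ← Ext.comp_assoc_of_second_deg_zero,
    Subsingleton.elim (x.comp (Ext.mk₀ h.i) (add_zero n)) 0, Ext.zero_comp]

end CategoryTheory.Retract

namespace ModuleCat

open Abelian

universe w v u

variable {R : Type u} [Ring R] [Small.{v} R]

lemma hasProjectiveDimensionLT_finsupp (I : Type v) (X : ModuleCat.{v} R) (n : ℕ)
    (hX : HasProjectiveDimensionLT X n) :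
    HasProjectiveDimensionLT (ModuleCat.of R (I →₀ X)) n := by
  match n with
  | 0 =>
    rw [hasProjectiveDimensionLT_zero_iff_isZero, isZero_iff_subsingleton] at hX ⊢
    infer_instance
  | 1 =>
    rw [← projective_iff_hasProjectiveDimensionLT_one] at hX ⊢
    have : Module.Projective R X := inferInstance
    classical
    exact (IsProjective.iff_projective _).1 (.of_equiv (finsuppLequivDFinsupp R).symm)
  | n + 2 =>
    have hS := X.shortExact_projectiveShortComplex
    have hK := (hS.hasProjectiveDimensionLT_X₃_iff n inferInstance).1 hX
    let f := X.projectiveShortComplex.f.hom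
    let g := X.projectiveShortComplex.g.hom
    have hfg : Function.Exact f g :=
      (ShortComplex.ShortExact.moduleCat_exact_iff_function_exact _).1 hS.exact
    let T : ShortComplex (ModuleCat.{v} R) := ModuleCat.shortComplexOfCompEqZero
      (Finsupp.mapRange.linearMap (α := I) f) (Finsupp.mapRange.linearMap g) (by
        rw [← Finsupp.mapRange.linearMap_comp, hfg.linearMap_comp_eq_zero]; ext; simp)
    have hT : T.ShortExact := by
      refine shortComplex_shortExact T (fun x ↦ ?_) ?_ ?_
      · change Finsupp.mapRange.linearMap g x = 0 ↔ x ∈ Set.range (Finsupp.mapRange.linearMap f)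
        rw [← LinearMap.mem_ker, Finsupp.ker_mapRange, Finsupp.mem_submodule_iff,
          ← LinearMap.coe_range, SetLike.mem_coe, Finsupp.range_mapRange_linearMap _
            (LinearMap.ker_eq_bot.2 hS.moduleCat_injective_f), Finsupp.mem_submodule_iff,
          hfg.linearMap_ker_eq]
      · exact Finsupp.mapRange_injective _ (map_zero f) hS.moduleCat_injective_f
      · exact Finsupp.mapRange_surjective _ (map_zero g) hS.moduleCat_surjective_g
    have : Projective T.X₂ := (IsProjective.iff_projective _).1 inferInstance
    exact (hT.hasProjectiveDimensionLT_X₃_iff n this).2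
      (hasProjectiveDimensionLT_finsupp I _ (n + 1) hK)

lemma subsingleton_ext_pi [HasExt.{w} (ModuleCat.{v} R)] (I : Type v) (X Y : ModuleCat.{v} R)
    (n : ℕ) (h : Subsingleton (Ext X Y (n + 1))) :
    Subsingleton (Ext X (ModuleCat.of R (I → Y)) (n + 1)) := by
  have hS := X.shortExact_projectiveShortComplex
  induction n generalizing X with
  | zero =>
    rw [zero_add, hS.subsingleton_ext_one_iff] at h ⊢
    intro g
    choose k hk using fun i ↦ h (g ≫ ModuleCat.ofHom (LinearMap.proj i))
    refine ⟨ModuleCat.ofHom (LinearMap.pi fun i ↦ (k i).hom), ?_⟩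
    ext x i
    exact congr($(hk i) x)
  | succ n ih =>
    rw [add_assoc, hS.subsingleton_ext_add_two_iff] at h ⊢
    exact ih _ h (shortExact_projectiveShortComplex _)

end ModuleCat

section Torsion

open Module

variable {R : Type*} [Ring R] {I : Ideal R} [I.IsTwoSided] [IsSemisimpleRing (R ⧸ I)]
  {M : Type*} [AddCommGroup M] [Module R M]

/-- A module annihilated by an ideal with semisimple quotient ring is semisimple. -/
lemma Module.IsTorsionBySet.isSemisimpleModule (h : IsTorsionBySet R M I) :
    IsSemisimpleModule R M := by
  let _ := h.module
  exact (h.semilinearMap.isSemisimpleModule_iff_of_bijective Function.bijective_id).2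
    inferInstance

end Torsion

namespace IsSemiprimary

variable {A : Type} [Ring A]

lemma asIdeal_jrad (A : Type) [Ring A] : (jrad A).asIdeal = Ring.jacobson A := by
  rw [jrad, TwoSidedIdeal.asIdeal_jacobson, TwoSidedIdeal.bot_asIdeal, Ideal.jacobson_bot]

lemma mul_eq_zero_of_mem_pow (J : Ideal A) (n : ℕ) (z : A)
    (h : ∀ x : Fin n → A, (∀ i, x i ∈ J) → (List.ofFn x).prod * z = 0) :
    ∀ y ∈ J ^ n, y * z = 0 := by
  induction n generalizing z with
  | zero => 
    intro y hy
    have := h Fin.elim0 (fun i ↦ i.elim0)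
    simp at this
    simp [this]
  | succ n ih =>
    suffices J ^ (n + 1) ≤ LinearMap.ker (LinearMap.toSpanSingleton A A z) from
      fun y hy ↦ this hy
    rw [Submodule.pow_succ]
    refine Ideal.mul_le.2 fun a ha b hb ↦ ?_
    have : a * (b * z) = 0 := ih (b * z) (fun x hx ↦ by
      have := h (Fin.snoc x b) (Fin.lastCases (by simpa) (by simpa))
      rw [List.ofFn_succ'] at this
      simpa [List.concat_eq_append, mul_assoc] using this) a ha
    simpa [mul_assoc] using this

lemma isSemisimpleRing_quotient (hA : IsSemiprimary A) (I : Ideal A) [I.IsTwoSided]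
    (hI : (jrad A).asIdeal ≤ I) : IsSemisimpleRing (A ⧸ I) := by
  have : IsSemisimpleRing (jrad A).ringCon.Quotient := hA.1
  refine RingHom.isSemisimpleRing_of_surjective
    ((jrad A).ringCon.lift (Ideal.Quotient.mk I) fun x y hxy ↦ ?_) fun y ↦ ?_
  · exact Ideal.Quotient.eq.2
      (hI (TwoSidedIdeal.mem_asIdeal.2 ((TwoSidedIdeal.rel_iff _ _ _).1 hxy)))
  · obtain ⟨x, rfl⟩ := Ideal.Quotient.mk_surjective y
    exact ⟨(jrad A).ringCon.mk' x, rfl⟩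

lemma isSemiprimaryRing (hA : IsSemiprimary A) : IsSemiprimaryRing A := by
  refine ⟨hA.isSemisimpleRing_quotient _ (asIdeal_jrad A).le, ?_⟩
  obtain ⟨-, n, hn⟩ := hA
  refine ⟨n, ?_⟩
  rw [← asIdeal_jrad]
  refine (Submodule.eq_bot_iff _).2 fun y hy ↦ ?_
  simpa using mul_eq_zero_of_mem_pow _ n 1 (fun x hx ↦ by
    rw [hn x fun i ↦ TwoSidedIdeal.mem_asIdeal.1 (hx i), zero_mul]) y hy

end IsSemiprimary

namespace Module.IsTorsionBySet

open CategoryTheory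

variable {R : Type*} [Ring R] {I : Ideal R} {M : Type*} [AddCommGroup M] [Module R M]

/-- The canonical surjection onto a module annihilated by `I` from a direct sum of copies
of `R ⧸ I`. -/
def finsuppQuotient (h : IsTorsionBySet R M I) : (M →₀ R ⧸ I) →ₗ[R] M :=
  Finsupp.lsum ℕ fun m ↦
    Submodule.liftQ I (LinearMap.toSpanSingleton R M m) fun a ha ↦
      LinearMap.mem_ker.2 (@h m ⟨a, ha⟩)

lemma finsuppQuotient_surjective (h : IsTorsionBySet R M I) :
    Function.Surjective h.finsuppQuotient := fun m ↦
  ⟨Finsupp.single m (Submodule.Quotient.mk 1), by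
    rw [finsuppQuotient, Finsupp.lsum_single, Submodule.liftQ_apply]
    exact one_smul R m⟩

lemma quotient_self [I.IsTwoSided] : IsTorsionBySet R (R ⧸ I) I :=
  (isTorsionBySet_quotient_iff _ _).2 fun x _ hr ↦ I.mul_mem_right x hr

end Module.IsTorsionBySet

namespace ModuleCat

open Module

universe v u

variable {R : Type v} [Ring R] {I : Ideal R} [I.IsTwoSided] [IsSemisimpleRing (R ⧸ I)]
  {M : Type v} [AddCommGroup M] [Module R M]

lemma nonempty_retract_finsupp_quotient (h : IsTorsionBySet R M I) :
    Nonempty (Retract (ModuleCat.of R M) (ModuleCat.of R (M →₀ R ⧸ I))) := by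
  have : IsSemisimpleModule R (M →₀ R ⧸ I) := IsTorsionBySet.isSemisimpleModule (I := I)
    fun x a ↦ Finsupp.ext fun i ↦ @IsTorsionBySet.quotient_self R _ I _ (x i) a
  obtain ⟨s, hs⟩ := IsSemisimpleModule.lifting_property h.finsuppQuotient
    h.finsuppQuotient_surjective .id
  exact ⟨⟨ModuleCat.ofHom s, ModuleCat.ofHom h.finsuppQuotient, ModuleCat.hom_ext hs⟩⟩

lemma nonempty_retract_pi_quotient (h : IsTorsionBySet R M I) :
    Nonempty (Retract (ModuleCat.of R M) (ModuleCat.of R (M → R ⧸ I))) := by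
  obtain ⟨r⟩ := nonempty_retract_finsupp_quotient h
  have : IsSemisimpleModule R (M → R ⧸ I) := IsTorsionBySet.isSemisimpleModule (I := I)
    fun x a ↦ funext fun i ↦ @IsTorsionBySet.quotient_self R _ I _ (x i) a
  let i : M →ₗ[R] M → R ⧸ I := Finsupp.lcoeFun ∘ₗ r.i.hom
  have hi : Function.Injective i := (DFunLike.coe_injective (F := M →₀ R ⧸ I)).comp
    (Function.LeftInverse.injective (g := r.r.hom) fun x ↦ congr($r.retract x))
  obtain ⟨p, hp⟩ := IsSemisimpleModule.extension_property i hi .id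
  exact ⟨⟨ModuleCat.ofHom i, ModuleCat.ofHom p, ModuleCat.hom_ext hp⟩⟩

end ModuleCat

namespace IsSemiprimary

open Abelian

universe w

variable {A : Type} [Ring A]

/-- A property of modules over a semiprimary ring that is stable under extensions and holds
for the modules annihilated by the Jacobson radical holds for all modules. -/
lemma induction (hA : IsSemiprimary A) {P : ModuleCat.{0} A → Prop}
    (h0 : ∀ (M : Type) [AddCommGroup M] [Module A M],
      Module.IsTorsionBySet A M (jrad A).asIdeal → P (ModuleCat.of A M))
    (h1 : ∀ S : ShortComplex (ModuleCat.{0} A), S.ShortExact → P S.X₁ → P S.X₃ → P S.X₂)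
    (M : ModuleCat.{0} A) : P M := by
  have := hA.isSemiprimaryRing
  refine IsSemiprimaryRing.induction ℤ A M (P := fun M _ _ _ ↦ P (ModuleCat.of A M))
    (fun M _ _ _ _ _ h ↦ h0 M (by rwa [asIdeal_jrad])) (fun M _ _ _ _ ↦ ?_)
  intro N hN hQ
  exact h1 (ModuleCat.shortComplexOfCompEqZero N.subtype N.mkQ (by ext; simp))
    (ModuleCat.shortComplex_shortExact _ (LinearMap.exact_subtype_mkQ N) N.injective_subtype
      N.mkQ_surjective) hN hQ

variable [HasExt.{w} (ModuleCat.{0} A)]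

lemma hasProjectiveDimensionLT_of_subsingleton_ext (hA : IsSemiprimary A) (n : ℕ)
    (h : Subsingleton (Ext (AmodJ A) (AmodJ A) (n + 1))) (M : ModuleCat.{0} A) :
    HasProjectiveDimensionLT M (n + 1) := by
  have := hA.isSemisimpleRing_quotient _ le_rfl
  have hJ : HasProjectiveDimensionLT (AmodJ A) (n + 1) := by
    refine hasProjectiveDimensionLT_of_enoughInjectives _ _ (hA.induction (fun M _ _ hM ↦ ?_)
      fun S hS h₁ h₃ ↦ subsingleton_of_forall_eq 0 fun x ↦ ?_)
    · obtain ⟨r⟩ := ModuleCat.nonempty_retract_pi_quotient hM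
      have : Subsingleton (Ext (AmodJ A)
          (ModuleCat.of A (M → A ⧸ (jrad A).asIdeal)) (n + 1)) :=
        ModuleCat.subsingleton_ext_pi M _ (AmodJ A) n h
      exact r.subsingleton_ext (AmodJ A) (n + 1)
    · obtain ⟨y, rfl⟩ := Ext.covariant_sequence_exact₂ _ hS x (Subsingleton.elim _ _)
      rw [Subsingleton.elim y 0, Ext.zero_comp]
  refine hA.induction (P := fun M ↦ HasProjectiveDimensionLT M (n + 1)) (fun M _ _ hM ↦ ?_)
    (fun S hS h₁ h₃ ↦ hS.hasProjectiveDimensionLT_X₂ _ h₁ h₃) M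
  obtain ⟨r⟩ := ModuleCat.nonempty_retract_finsupp_quotient hM
  have : HasProjectiveDimensionLT
      (ModuleCat.of A (M →₀ A ⧸ (jrad A).asIdeal)) (n + 1) :=
    ModuleCat.hasProjectiveDimensionLT_finsupp M (AmodJ A) _ hJ
  exact r.hasProjectiveDimensionLT (n + 1)

end IsSemiprimary

lemma projDim_ne_top_iff (A : Type) [Ring A] (M : ModuleCat.{0} A) :
    projDim A M ≠ ⊤ ↔ ∃ n : ℕ, projDimLE A M n := by
  rw [← lt_top_iff_ne_top, projDim, sInf_lt_iff]
  exact ⟨fun ⟨_, ⟨n, _, hn⟩, _⟩ ↦ ⟨n, hn⟩, fun ⟨n, hn⟩ ↦ ⟨n, ⟨n, rfl, hn⟩, ENat.natCast_lt_top n⟩⟩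

/-- A semiprimary ring has finite global dimension iff `Ext^n(A/J, A/J) = 0`
for some `n > 0`. -/
theorem stmt_0 (A : Type) [Ring A] (hA : IsSemiprimary A) :
    globalDim A ≠ ⊤ ↔
      ∃ n : ℕ, 0 < n ∧ Subsingleton (Abelian.Ext (AmodJ A) (AmodJ A) n) := by
  constructor
  · intro h
    obtain ⟨n, hn⟩ := (projDim_ne_top_iff A (AmodJ A)).1
      (ne_top_of_le_ne_top h (le_iSup (projDim A) (AmodJ A)))
    exact ⟨n + 1, n.succ_pos, hn _ _ n.lt_succ_self⟩
  · rintro ⟨_ | n, hn, h⟩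
    · exact absurd hn (lt_irrefl 0)
    · refine ne_top_of_le_ne_top (ENat.natCast_ne_top n) (iSup_le fun M ↦ sInf_le ⟨n, rfl, ?_⟩)
      have := hA.hasProjectiveDimensionLT_of_subsingleton_ext n h M
      exact fun N k hk ↦ HasProjectiveDimensionLT.subsingleton M (n + 1) k hk N

end
end

section
/- Let A be a semiprimary ring with Jacobson radical J. Then the left global dimension of A equals the supremum of the projective dimensions of the simple left A-modules. -/
open CategoryTheory

noncomputable section

/-- If `Ext¹(Z, N) = 0`, linear maps to `N` extend along an injection with cokernel `Z`. -/
theorem exists_extension_of_subsingleton_ext_one {A : Type} [Ring A]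
    {X Y Z N : Type} [AddCommGroup X] [Module A X] [AddCommGroup Y] [Module A Y]
    [AddCommGroup Z] [Module A Z] [AddCommGroup N] [Module A N]
    (i : X →ₗ[A] Y) (π : Y →ₗ[A] Z) (hi : Function.Injective i) (hπ : Function.Surjective π)
    (hex : Function.Exact i π)
    (h : Subsingleton (Abelian.Ext (ModuleCat.of A Z) (ModuleCat.of A N) 1)) (f : X →ₗ[A] N) :
    ∃ g : Y →ₗ[A] N, g ∘ₗ i = f := by
  let S : ShortComplex (ModuleCat.{0} A) :=
    ShortComplex.mk (ModuleCat.ofHom i) (ModuleCat.ofHom π)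
      (by ext x; exact hex.apply_apply_eq_zero x)
  have hS : S.ShortExact :=
    { exact := (ShortComplex.ShortExact.moduleCat_exact_iff_function_exact S).2 hex
      mono_f := (ModuleCat.mono_iff_injective _).2 hi
      epi_g := (ModuleCat.epi_iff_surjective _).2 hπ }
  obtain ⟨φ, hφ⟩ := Abelian.Ext.contravariant_sequence_exact₁ hS (ModuleCat.of A N)
    (Abelian.Ext.mk₀ (ModuleCat.ofHom f)) (zero_add 1) (h.elim _ _)
  obtain ⟨φ, rfl⟩ := Abelian.Ext.homEquiv₀.symm.surjective φ
  have hcomp : S.f ≫ φ = ModuleCat.ofHom f :=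
    Abelian.Ext.homEquiv₀.symm.injective (by simpa using hφ)
  exact ⟨φ.hom, congrArg ModuleCat.Hom.hom hcomp⟩

/-- Over a ring all of whose nonzero modules contain a simple submodule, a module `N` with
`Ext¹(S, N) = 0` for every simple module `S` is injective. -/
theorem injective_of_subsingleton_ext_one_of_isSimpleModule {A : Type} [Ring A]
    (hA : ∀ (M : Type) [AddCommGroup M] [Module A M] [Nontrivial M],
      ∃ T : Submodule A M, IsSimpleModule A T)
    (N : ModuleCat.{0} A)
    (hN : ∀ S : ModuleCat.{0} A, IsSimpleModule A S → Subsingleton (Abelian.Ext S N 1)) :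
    Injective N := by
  suffices Module.Injective A N from Module.injective_object_of_injective_module A N
  refine ⟨fun X Y _ _ _ _ i hi f => ?_⟩
  have : Fact (Function.Injective i) := ⟨hi⟩
  let p := Module.Baer.extensionOfMax i f
  have htop : p.domain = ⊤ := by
    by_contra hne
    have : Nontrivial (Y ⧸ p.domain) := Submodule.Quotient.nontrivial_iff.2 hne
    obtain ⟨T, hT⟩ := hA (Y ⧸ p.domain)
    let D : Submodule A Y := T.comap p.domain.mkQ
    have hle : p.domain ≤ D := fun x hx => by
      simp [D, (Submodule.Quotient.mk_eq_zero p.domain).2 hx]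
    let π : D →ₗ[A] T := p.domain.mkQ.restrict fun _ hx => hx
    have hπ : Function.Surjective π := by
      rintro ⟨t, ht⟩
      obtain ⟨y, rfl⟩ := p.domain.mkQ_surjective t
      exact ⟨⟨y, ht⟩, rfl⟩
    have hex : Function.Exact (Submodule.inclusion hle) π := by
      intro y
      rw [← Submodule.coe_eq_zero]
      refine (Submodule.Quotient.mk_eq_zero p.domain).trans ⟨fun hy => ⟨⟨y, hy⟩, rfl⟩, ?_⟩
      rintro ⟨x, rfl⟩
      exact x.2
    obtain ⟨g, hg⟩ := exists_extension_of_subsingleton_ext_one (Submodule.inclusion hle) π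
      (Submodule.inclusion_injective hle) hπ hex (hN (ModuleCat.of A T) hT) p.toFun
    let q : Module.Baer.ExtensionOf i f :=
      { domain := D
        toFun := g
        le := p.le.trans hle
        is_extension := fun m =>
          (p.is_extension m).trans (LinearMap.congr_fun hg ⟨i m, p.le ⟨m, rfl⟩⟩).symm }
    have hpq : p ≤ q := by
      refine ⟨hle, fun x y hxy => ?_⟩
      obtain rfl : Submodule.inclusion hle x = y := Subtype.ext hxy
      exact (LinearMap.congr_fun hg x).symm
    have hD : D = p.domain :=
      congrArg (fun e : Module.Baer.ExtensionOf i f => e.domain)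
        (Module.Baer.extensionOfMax_is_max i f q hpq)
    have := IsSimpleModule.nontrivial A T
    obtain ⟨t, ht⟩ := exists_ne (0 : T)
    obtain ⟨y, rfl⟩ := hπ t
    exact ht (Subtype.ext ((Submodule.Quotient.mk_eq_zero p.domain).2 (hD ▸ y.2)))
  exact ⟨p.toFun ∘ₗ LinearMap.codRestrict p.domain LinearMap.id fun y => htop ▸ trivial,
    fun x => (p.is_extension x).symm⟩

/-- Over a ring all of whose nonzero modules contain a simple submodule, the injective dimension
of a module `N` is at most `n` as soon as `Extⁿ⁺¹(S, N) = 0` for every simple module `S`. -/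
theorem hasInjectiveDimensionLE_of_isSimpleModule {A : Type} [Ring A]
    (hA : ∀ (M : Type) [AddCommGroup M] [Module A M] [Nontrivial M],
      ∃ T : Submodule A M, IsSimpleModule A T)
    (n : ℕ) (N : ModuleCat.{0} A)
    (hN : ∀ S : ModuleCat.{0} A, IsSimpleModule A S → Subsingleton (Abelian.Ext S N (n + 1))) :
    HasInjectiveDimensionLE N n := by
  induction n generalizing N with
  | zero =>
    have := injective_of_subsingleton_ext_one_of_isSimpleModule hA N hN
    infer_instance
  | succ n ih =>
    let S : ShortComplex (ModuleCat.{0} A) :=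
      ShortComplex.mk (Injective.ι N) (Limits.cokernel.π (Injective.ι N))
        (Limits.cokernel.condition _)
    have hS : S.ShortExact := { exact := ShortComplex.exact_cokernel (Injective.ι N) }
    have hinj : Injective S.X₂ := inferInstanceAs (Injective (Injective.under N))
    refine (hS.hasInjectiveDimensionLT_X₃_iff n hinj).1 (ih S.X₃ fun T hT => ?_)
    refine subsingleton_of_forall_eq 0 fun x => ?_
    obtain ⟨y, rfl⟩ := Abelian.Ext.covariant_sequence_exact₃ T hS x rfl ((hN T hT).elim _ _)
    rw [y.eq_zero_of_hasInjectiveDimensionLT 1 (by lia), Abelian.Ext.zero_comp]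

/-- If products of `n` elements of the Jacobson radical vanish for some `n`, every nonzero module
has a nonzero element killed by the radical. -/
theorem exists_ne_zero_forall_jrad_smul_eq_zero {A : Type} [Ring A]
    (hA : ∃ n : ℕ, ∀ x : Fin n → A, (∀ i, x i ∈ jrad A) → (List.ofFn x).prod = 0)
    (M : Type) [AddCommGroup M] [Module A M] [Nontrivial M] :
    ∃ m : M, m ≠ 0 ∧ ∀ a ∈ jrad A, a • m = 0 := by
  by_contra! h
  obtain ⟨n, hn⟩ := hA
  obtain ⟨m, hm⟩ := exists_ne (0 : M)
  have key : ∀ k : ℕ, ∃ x : Fin k → A, (∀ i, x i ∈ jrad A) ∧ (List.ofFn x).prod • m ≠ 0 := by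
    intro k
    induction k with
    | zero => exact ⟨Fin.elim0, fun i => i.elim0, by simpa using hm⟩
    | succ k ih =>
      obtain ⟨x, hx, hxm⟩ := ih
      obtain ⟨a, ha, ham⟩ := h _ hxm
      refine ⟨Fin.cons a x, Fin.cases ha hx, ?_⟩
      simpa [List.ofFn_succ, mul_smul] using ham
  obtain ⟨x, hx, hxm⟩ := key n
  exact hxm (by rw [hn x hx, zero_smul])

/-- If `A/J` is a semisimple ring, a cyclic module whose generator is killed by `J` is
semisimple. -/
theorem isSemisimpleModule_range_toSpanSingleton {A : Type} [Ring A] (hA : SemisimpleModJ A)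
    {M : Type} [AddCommGroup M] [Module A M] (m : M) (hm : ∀ a ∈ jrad A, a • m = 0) :
    IsSemisimpleModule A (LinearMap.range (LinearMap.toSpanSingleton A M m)) := by
  let Q := (jrad A).ringCon.Quotient
  let mk : A →+* Q := (jrad A).ringCon.mk'
  have hmk : Function.Surjective mk := (jrad A).ringCon.mk'_surjective
  have : RingHomSurjective mk := ⟨hmk⟩
  let : Module A Q := Module.compHom Q mk
  let e : Q →ₛₗ[mk] Q := { toFun := id, map_add' := fun _ _ => rfl, map_smul' := fun _ _ => rfl }
  have hQ : IsSemisimpleModule A Q :=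
    (e.isSemisimpleModule_iff_of_bijective Function.bijective_id).2 hA
  let q : A →ₗ[A] Q := { toFun := mk, map_add' := map_add mk, map_smul' := map_mul mk }
  have hker : LinearMap.ker q ≤ LinearMap.ker (LinearMap.toSpanSingleton A M m) := fun a ha =>
    hm a ((TwoSidedIdeal.mem_iff _ _).2 ((RingCon.eq _).1 (ha : mk a = 0)))
  have : IsSemisimpleModule A (A ⧸ LinearMap.ker q) :=
    .congr (q.quotKerEquivOfSurjective hmk)
  rw [← Submodule.range_liftQ _ _ hker]
  exact .range _

/-- Every nonzero module over a semiprimary ring contains a simple submodule. -/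
theorem IsSemiprimary.exists_simple_submodule {A : Type} [Ring A] (hA : IsSemiprimary A)
    (M : Type) [AddCommGroup M] [Module A M] [Nontrivial M] :
    ∃ T : Submodule A M, IsSimpleModule A T := by
  obtain ⟨m, hm, hJ⟩ := exists_ne_zero_forall_jrad_smul_eq_zero hA.2 M
  let C := LinearMap.range (LinearMap.toSpanSingleton A M m)
  have : IsSemisimpleModule A C := isSemisimpleModule_range_toSpanSingleton hA.1 m hJ
  have : Nontrivial C := ⟨⟨⟨m, 1, one_smul A m⟩, 0, fun h => hm (congrArg Subtype.val h)⟩⟩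
  obtain ⟨T, hT⟩ := IsSemisimpleModule.exists_simple_submodule A C
  exact ⟨T.map C.subtype, .congr (T.equivMapOfInjective C.subtype C.injective_subtype).symm⟩

theorem projDim_le_natCast_iff {A : Type} [Ring A] (M : ModuleCat.{0} A) (n : ℕ) :
    projDim A M ≤ n ↔ projDimLE A M n := by
  refine ⟨fun h N k hk => ?_, fun h => sInf_le ⟨n, rfl, h⟩⟩
  obtain ⟨_, ⟨m, rfl, hm⟩, hlt⟩ := sInf_lt_iff.1 (h.trans_lt (Nat.cast_lt.2 hk))
  exact hm N k (Nat.cast_lt.1 hlt)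

/-- The global dimension of a semiprimary ring is the supremum of the projective
dimensions of the simple modules. -/
theorem stmt_1 (A : Type) [Ring A] (hA : IsSemiprimary A) :
    globalDim A = ⨆ (S : ModuleCat.{0} A) (_ : IsSimpleModule A S), projDim A S := by
  refine le_antisymm ?_ (iSup₂_le fun S _ => le_iSup (projDim A) S)
  refine iSup_le fun M => ?_
  generalize hd : (⨆ (S : ModuleCat.{0} A) (_ : IsSimpleModule A S), projDim A S) = d
  cases d with
  | top => exact le_top
  | coe n =>
    have hsimple (S : ModuleCat.{0} A) (hS : IsSimpleModule A S) : projDimLE A S n :=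
      (projDim_le_natCast_iff S n).1 ((le_iSup₂_of_le S hS le_rfl).trans hd.le)
    refine (projDim_le_natCast_iff M n).2 fun N k hk => ?_
    have := hasInjectiveDimensionLE_of_isSimpleModule hA.exists_simple_submodule n N
      fun S hS => hsimple S hS N (n + 1) n.lt_succ_self
    exact HasInjectiveDimensionLT.subsingleton N (n + 1) k hk M

end
end

section
/- Let A be a semiprimary ring such that the Yoneda ring E = ⊕_{n≥0} Ext_A^n(A/J, A/J) is generated in finite degrees, and suppose there exists m > 0 such that Ext_A^n(S, S) = 0 for all simple A-modules S and all n ≥ m. Then A has finite global dimension. -/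
open CategoryTheory

noncomputable section

namespace CategoryTheory.Abelian.Ext

open Limits

universe w v u

variable {C : Type u} [Category.{v} C] [Abelian C] [HasExt.{w} C]

/-- `IsChain S p q L n x` says that `x` is a Yoneda product of classes of positive degrees
going from `S p` to `S q`, where `L` lists the indices of the sources of the successive factors
and `n` is the total degree. -/
inductive IsChain {κ : Type} (S : κ → C) :
    ∀ (p q : κ), List κ → ∀ n : ℕ, Ext (S p) (S q) n → Prop
  | nil (p : κ) : IsChain S p p [] 0 (mk₀ (𝟙 (S p)))
  | cons {p q r : κ} {L : List κ} {i j n : ℕ} (h : i + j = n) (hi : 0 < i)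
      (a : Ext (S p) (S q) i) {x : Ext (S q) (S r) j} (hx : IsChain S q r L j x) :
      IsChain S p r (p :: L) n (a.comp x h)

namespace IsChain

variable {κ : Type} {S : κ → C}

lemma single {p q : κ} {n : ℕ} (hn : 0 < n) (a : Ext (S p) (S q) n) :
    IsChain S p q [p] n a := by
  simpa using cons (add_zero n) hn a (nil q)

lemma append {p q r : κ} {L L' : List κ} {i j n : ℕ} (h : i + j = n)
    {x : Ext (S p) (S q) i} {y : Ext (S q) (S r) j}
    (hx : IsChain S p q L i x) (hy : IsChain S q r L' j y) :
    IsChain S p r (L ++ L') n (x.comp y h) := by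
  induction hx generalizing n with
  | nil p =>
    obtain rfl : j = n := by lia
    simpa using hy
  | @cons p q' r' L i' j' n' h' hi a x hx ih =>
    rw [comp_assoc a x y h' rfl (by lia)]
    exact cons _ hi a (ih rfl hy)

variable [DecidableEq κ]

/-- A chain visiting `w` splits at its last visit of `w`. -/
lemma exists_split_last {p r : κ} {L : List κ} {n : ℕ} {x : Ext (S p) (S r) n}
    (hx : IsChain S p r L n x) {w : κ} (hw : 0 < L.count w) :
    ∃ (i j : ℕ) (h : i + j = n) (y : Ext (S p) (S w) i) (z : Ext (S w) (S r) j),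
      L.count w ≤ i + 1 ∧ x = y.comp z h := by
  induction hx with
  | nil p => simp at hw
  | @cons p q r L i j n h hi a x hx ih =>
    by_cases hL : 0 < L.count w
    · obtain ⟨i', j', h', y, z, hc, rfl⟩ := ih hL
      refine ⟨i + i', j', by lia, a.comp y rfl, z, ?_, ?_⟩
      · rw [List.count_cons]; split_ifs <;> lia
      · rw [comp_assoc a y z rfl h' (by lia)]
    · obtain rfl : p = w := by
        by_contra hne
        simp [hne] at hw hL
        contradiction
      refine ⟨0, n, by lia, mk₀ (𝟙 _), a.comp x h, ?_, by simp⟩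
      rw [List.count_cons]; split_ifs <;> lia

/-- A chain visiting `w` splits at its first and last visits of `w`. -/
lemma exists_split {p r : κ} {L : List κ} {n : ℕ} {x : Ext (S p) (S r) n}
    (hx : IsChain S p r L n x) {w : κ} (hw : 0 < L.count w) :
    ∃ (i j k l : ℕ) (h : j + k = l) (h' : i + l = n) (y : Ext (S p) (S w) i)
      (u : Ext (S w) (S w) j) (z : Ext (S w) (S r) k),
      L.count w ≤ j + 1 ∧ x = y.comp (u.comp z h) h' := by
  induction hx with
  | nil p => simp at hw
  | @cons p q r L i j n h hi a x hx ih =>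
    by_cases hp : p = w
    · subst hp
      obtain ⟨j', k, h', u, z, hc, e⟩ := (cons h hi a hx).exists_split_last hw
      exact ⟨0, j', k, n, h', by lia, mk₀ (𝟙 _), u, z, hc, by simp [e]⟩
    · rw [List.count_cons_of_ne hp] at hw ⊢
      obtain ⟨i', j', k, l, h₁, h₂, y, u, z, hc, rfl⟩ := ih hw
      refine ⟨i + i', j', k, l, h₁, by lia, a.comp y rfl, u, z, hc, ?_⟩
      rw [comp_assoc a y (u.comp z h₁) rfl h₂ (by lia)]

/-- Long chains vanish when the self-extensions vanish in large degrees. -/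
lemma eq_zero [Fintype κ] {m : ℕ} (hS : ∀ p n, m ≤ n → Subsingleton (Ext (S p) (S p) n))
    {p r : κ} {L : List κ} {n : ℕ} {x : Ext (S p) (S r) n} (hx : IsChain S p r L n x)
    (hL : Fintype.card κ * m < L.length) : x = 0 := by
  obtain ⟨w, hw⟩ : ∃ w, m < L.count w := by
    by_contra! hc
    have h₁ : ∑ w, L.count w = L.length := by
      simpa using Multiset.sum_count_eq_card (s := Finset.univ) (m := (L : Multiset κ)) (by simp)
    have h₂ := Finset.sum_le_card_nsmul Finset.univ (fun w ↦ L.count w) m (by simpa using hc)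
    simp at h₂
    lia
  obtain ⟨i, j, k, l, h, h', y, u, z, hj, rfl⟩ := hx.exists_split (w := w) (by lia)
  have := hS w j (by lia)
  rw [Subsingleton.elim u 0, zero_comp, comp_zero]

end IsChain

/-- If the self-extensions of each of finitely many objects `S p` vanish in large degrees, and
every extension of large degree of `⨁ S` is a sum of products of extensions of smaller positive
degrees, then the self-extensions of `⨁ S` vanish in large degrees. -/
theorem exists_subsingleton_of_generated {κ : Type} [Fintype κ] {S : κ → C} {c : Limits.Bicone S}
    (hc : c.IsBilimit) {m : ℕ} (hS : ∀ p n, m ≤ n → Subsingleton (Ext (S p) (S p) n)) {s : ℕ}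
    (hgen : ∀ n, s < n → ∀ e : Ext c.pt c.pt n,
      e ∈ AddSubgroup.closure {x : Ext c.pt c.pt n |
        ∃ (i j : ℕ) (h : i + j = n) (_ : 0 < i) (_ : 0 < j)
          (a : Ext c.pt c.pt i) (b : Ext c.pt c.pt j), x = a.comp b h}) :
    ∃ N, ∀ n, N < n → Subsingleton (Ext c.pt c.pt n) := by
  classical
  let T (n : ℕ) : AddSubgroup (Ext c.pt c.pt n) := AddSubgroup.closure {x |
    ∃ (p q : κ) (L : List κ) (y : Ext (S p) (S q) n), IsChain S p q L n y ∧ n ≤ s * L.length ∧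
      x = (mk₀ (c.π p)).comp (y.comp (mk₀ (c.ι q)) (add_zero n)) (zero_add n)}
  have hmul {i j n : ℕ} (h : i + j = n) {a : Ext c.pt c.pt i} {b : Ext c.pt c.pt j}
      (ha : a ∈ T i) (hb : b ∈ T j) : a.comp b h ∈ T n := by
    induction ha using AddSubgroup.closure_induction with
    | zero => simp
    | add a a' _ _ h₁ h₂ => rw [add_comp]; exact add_mem h₁ h₂
    | neg a _ h₁ => rw [neg_comp]; exact neg_mem h₁
    | mem a ha =>
    induction hb using AddSubgroup.closure_induction with
    | zero => simp
    | add b b' _ _ h₁ h₂ => rw [comp_add]; exact add_mem h₁ h₂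
    | neg b _ h₁ => rw [comp_neg]; exact neg_mem h₁
    | mem b hb =>
    obtain ⟨p, q, L, y, hy, hL, rfl⟩ := ha
    obtain ⟨p', q', L', y', hy', hL', rfl⟩ := hb
    have key : ((mk₀ (c.π p)).comp (y.comp (mk₀ (c.ι q)) (add_zero i)) (zero_add i)).comp
        ((mk₀ (c.π p')).comp (y'.comp (mk₀ (c.ι q')) (add_zero j)) (zero_add j)) h =
        (mk₀ (c.π p)).comp ((y.comp ((mk₀ (c.ι q ≫ c.π p')).comp y' (zero_add j)) h).comp
          (mk₀ (c.ι q')) (add_zero n)) (zero_add n) := by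
      rw [← mk₀_comp_mk₀_assoc]
      rw [comp_assoc (mk₀ (c.π p)) _ _ (zero_add i) h (by lia)]
      congr 1
      rw [comp_assoc_of_second_deg_zero, comp_assoc y _ _ h (add_zero j) (by lia),
        comp_assoc (mk₀ (c.ι q)) _ _ (zero_add j) (add_zero j) (by lia),
        comp_assoc (mk₀ (c.π p')) _ _ (zero_add j) (add_zero j) (by lia)]
    rw [key]
    by_cases hq : q = p'
    · subst hq
      refine AddSubgroup.subset_closure ⟨p, q', L ++ L', y.comp y' h, hy.append h hy', ?_, ?_⟩
      · rw [List.length_append]; lia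
      · simp
    · simp [c.ι_π, hq]
  have hT (n : ℕ) (hn : 0 < n) (e : Ext c.pt c.pt n) : e ∈ T n := by
    induction n using Nat.strong_induction_on with
    | _ n ih =>
    by_cases hs : s < n
    · refine (AddSubgroup.closure_le _).2 ?_ (hgen n hs e)
      rintro _ ⟨i, j, h, hi, hj, a, b, rfl⟩
      exact hmul h (ih i (by lia) hi a) (ih j (by lia) hj b)
    · have he : e = ∑ p, ∑ q, (mk₀ (c.π p)).comp ((((mk₀ (c.ι p)).comp e (zero_add n)).comp
          (mk₀ (c.π q)) (add_zero n)).comp (mk₀ (c.ι q)) (add_zero n)) (zero_add n) := by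
        simp only [← comp_sum, comp_assoc_of_second_deg_zero, mk₀_comp_mk₀, ← mk₀_sum,
          IsBilimit.total hc, comp_mk₀_id, mk₀_comp_mk₀_assoc, ← sum_comp, mk₀_id_comp]
      rw [he]
      refine sum_mem fun p _ ↦ sum_mem fun q _ ↦ AddSubgroup.subset_closure
        ⟨p, q, [p], _, .single hn _, ?_, rfl⟩
      simp; lia
  refine ⟨s * (Fintype.card κ * m), fun n hn ↦ subsingleton_of_forall_eq 0 fun e ↦ ?_⟩
  refine AddSubgroup.mem_bot.1 ((AddSubgroup.closure_le _).2 ?_ (hT n (by lia) e))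
  rintro _ ⟨p, q, L, y, hy, hL, rfl⟩
  rw [hy.eq_zero hS (lt_of_mul_lt_mul_left (hn.trans_le hL) (Nat.zero_le s))]
  simp

/-- An extension of positive degree from a coproduct vanishes if it vanishes on each summand. -/
lemma eq_zero_of_cofan [EnoughInjectives C] {κ : Type*} {X : κ → C} {c : Cofan X}
    (hc : IsColimit c) {Y : C} {n : ℕ} (x : Ext c.pt Y (n + 1))
    (hx : ∀ i, (mk₀ (c.inj i)).comp x (zero_add _) = 0) : x = 0 := by
  induction n generalizing Y with
  | zero =>
    let T := ShortComplex.mk _ _ (cokernel.condition (Injective.ι Y))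
    have hT : T.ShortExact :=
      { exact := ShortComplex.exact_of_g_is_cokernel _ (cokernelIsCokernel T.f) }
    obtain ⟨y, rfl⟩ := covariant_sequence_exact₁ c.pt hT x (eq_zero_of_injective _) rfl
    obtain ⟨f, rfl⟩ := (mk₀_bijective _ _).surjective y
    have (i : κ) : ∃ g : X i ⟶ T.X₂, g ≫ T.g = c.inj i ≫ f := by
      obtain ⟨z, hz⟩ := covariant_sequence_exact₃ (X i) hT (mk₀ (c.inj i ≫ f)) (zero_add 1)
        (by rw [← mk₀_comp_mk₀_assoc]; exact hx i)
      obtain ⟨g, rfl⟩ := (mk₀_bijective _ _).surjective z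
      exact ⟨g, (mk₀_bijective _ _).injective (by rw [← mk₀_comp_mk₀]; exact hz)⟩
    choose g hg using this
    have : f = Cofan.IsColimit.desc hc g ≫ T.g :=
      Cofan.IsColimit.hom_ext hc _ _ fun i ↦ by simp [hg]
    rw [this, ← mk₀_comp_mk₀, comp_assoc_of_second_deg_zero, hT.comp_extClass, comp_zero]
  | succ n ih =>
    let T := ShortComplex.mk _ _ (cokernel.condition (Injective.ι Y))
    have hT : T.ShortExact :=
      { exact := ShortComplex.exact_of_g_is_cokernel _ (cokernelIsCokernel T.f) }
    obtain ⟨y, rfl⟩ := covariant_sequence_exact₁ c.pt hT x (eq_zero_of_injective _) rfl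
    rw [ih y fun i ↦ ?_, zero_comp]
    obtain ⟨z, hz⟩ := covariant_sequence_exact₃ (X i) hT
      ((mk₀ (c.inj i)).comp y (zero_add _)) rfl
      (by rw [comp_assoc (mk₀ (c.inj i)) y _ (zero_add _) rfl (by lia)]; exact hx i)
    rw [← hz, z.eq_zero_of_injective, zero_comp]

/-- An extension of positive degree into a product vanishes if all its components do. -/
lemma eq_zero_of_fan [EnoughProjectives C] {κ : Type*} {Y : κ → C} {c : Fan Y}
    (hc : IsLimit c) {X : C} {n : ℕ} (x : Ext X c.pt (n + 1))
    (hx : ∀ i, x.comp (mk₀ (c.proj i)) (add_zero _) = 0) : x = 0 := by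
  induction n generalizing X with
  | zero =>
    let T := ShortComplex.mk _ _ (kernel.condition (Projective.π X))
    have hT : T.ShortExact :=
      { exact := ShortComplex.exact_of_f_is_kernel _ (kernelIsKernel T.g) }
    obtain ⟨y, rfl⟩ := contravariant_sequence_exact₃ hT c.pt x (eq_zero_of_projective _)
      (add_zero 1)
    obtain ⟨f, rfl⟩ := (mk₀_bijective _ _).surjective y
    have (i : κ) : ∃ g : T.X₂ ⟶ Y i, T.f ≫ g = f ≫ c.proj i := by
      obtain ⟨z, hz⟩ := contravariant_sequence_exact₁ hT (Y i) (mk₀ (f ≫ c.proj i)) (add_zero 1)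
        (by rw [← mk₀_comp_mk₀, ← comp_assoc_of_third_deg_zero]; exact hx i)
      obtain ⟨g, rfl⟩ := (mk₀_bijective _ _).surjective z
      exact ⟨g, (mk₀_bijective _ _).injective (by rw [← mk₀_comp_mk₀]; exact hz)⟩
    choose g hg using this
    have : f = T.f ≫ Fan.IsLimit.lift hc g :=
      Fan.IsLimit.hom_ext hc _ _ fun i ↦ by simp [hg]
    rw [this, ← mk₀_comp_mk₀, hT.extClass_comp_assoc]
  | succ n ih =>
    let T := ShortComplex.mk _ _ (kernel.condition (Projective.π X))
    have hT : T.ShortExact :=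
      { exact := ShortComplex.exact_of_f_is_kernel _ (kernelIsKernel T.g) }
    obtain ⟨y, rfl⟩ := contravariant_sequence_exact₃ hT c.pt x (eq_zero_of_projective _)
      (add_comm 1 (n + 1))
    rw [ih y fun i ↦ ?_, comp_zero]
    obtain ⟨z, hz⟩ := contravariant_sequence_exact₁ hT (Y i)
      (y.comp (mk₀ (c.proj i)) (add_zero _)) (add_comm 1 (n + 1))
      (by rw [← comp_assoc_of_third_deg_zero]; exact hx i)
    rw [← hz, z.eq_zero_of_projective, comp_zero]

lemma subsingleton_of_retract {X X' Y Y' : C} (hX : Retract X X') (hY : Retract Y Y') {n : ℕ}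
    [Subsingleton (Ext X' Y' n)] : Subsingleton (Ext X Y n) := by
  refine subsingleton_of_forall_eq 0 fun e ↦ ?_
  have : e = (mk₀ hX.i).comp ((((mk₀ hX.r).comp e (zero_add n)).comp (mk₀ hY.i)
      (add_zero n)).comp (mk₀ hY.r) (add_zero n)) (zero_add n) := by
    rw [comp_assoc_of_second_deg_zero, mk₀_comp_mk₀, hY.retract, comp_mk₀_id,
      mk₀_comp_mk₀_assoc, hX.retract, mk₀_id_comp]
  rw [this, Subsingleton.elim (((mk₀ hX.r).comp e (zero_add n)).comp (mk₀ hY.i) _) 0]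
  simp

lemma subsingleton_X₂_right {T : ShortComplex C} (hT : T.ShortExact) {X : C} {n : ℕ}
    [Subsingleton (Ext X T.X₁ n)] [Subsingleton (Ext X T.X₃ n)] :
    Subsingleton (Ext X T.X₂ n) := by
  refine subsingleton_of_forall_eq 0 fun e ↦ ?_
  obtain ⟨y, rfl⟩ := covariant_sequence_exact₂ X hT e (Subsingleton.elim _ _)
  rw [Subsingleton.elim y 0, zero_comp]

lemma subsingleton_X₂_left {T : ShortComplex C} (hT : T.ShortExact) {Y : C} {n : ℕ}
    [Subsingleton (Ext T.X₁ Y n)] [Subsingleton (Ext T.X₃ Y n)] :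
    Subsingleton (Ext T.X₂ Y n) := by
  refine subsingleton_of_forall_eq 0 fun e ↦ ?_
  obtain ⟨y, rfl⟩ := contravariant_sequence_exact₂ hT Y e (Subsingleton.elim _ _)
  rw [Subsingleton.elim y 0, comp_zero]

end CategoryTheory.Abelian.Ext

lemma asIdeal_jrad (A : Type) [Ring A] : (jrad A).asIdeal = Ring.jacobson A := by
  rw [jrad, TwoSidedIdeal.asIdeal_jacobson, TwoSidedIdeal.bot_asIdeal, Ideal.jacobson_bot]

lemma IsSemiprimary.isSemiprimaryRing_s3 {A : Type} [Ring A] (hA : IsSemiprimary A) :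
    IsSemiprimaryRing A := by
  obtain ⟨hss, n, hn⟩ := hA
  constructor
  · have : IsSemisimpleRing (jrad A).ringCon.Quotient := hss
    let f : (jrad A).ringCon.Quotient →+* A ⧸ Ring.jacobson A :=
      RingCon.lift _ (Ideal.Quotient.mk (Ring.jacobson A)) fun x y h ↦ by
        rw [RingCon.ker_apply, Ideal.Quotient.mk_eq_mk_iff_sub_mem, ← asIdeal_jrad,
          TwoSidedIdeal.mem_asIdeal]
        exact ((jrad A).rel_iff x y).1 h
    refine f.isSemisimpleRing_of_surjective fun y ↦ ?_
    obtain ⟨x, rfl⟩ := Ideal.Quotient.mk_surjective y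
    exact ⟨(x : (jrad A).ringCon.Quotient), rfl⟩
  · refine ⟨n, ?_⟩
    rw [← asIdeal_jrad]
    have key (k : ℕ) (z : A) (hz : z ∈ (jrad A).asIdeal ^ k) (l : List A) (hl : l.length + k = n)
        (hl' : ∀ x ∈ l, x ∈ jrad A) : l.prod * z = 0 := by
      induction k generalizing z l with
      | zero =>
        have := hn (fun i ↦ l.get (i.cast (by lia))) fun i ↦ hl' _ (List.get_mem _ _)
        subst hl
        have h : List.ofFn l.get = l := List.ofFn_get l
        simp_all
      | succ k ih =>
        rw [Ideal.IsTwoSided.pow_succ] at hz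
        induction hz using Submodule.smul_induction_on' with
        | smul x hx y hy =>
          have := ih y hy (l ++ [x]) (by simp; lia) (by
            intro w hw
            rcases List.mem_append.1 hw with hw | hw
            · exact hl' w hw
            · rw [List.mem_singleton.1 hw]; exact TwoSidedIdeal.mem_asIdeal.1 hx)
          simpa [mul_assoc] using this
        | add x _ y _ hx hy => rw [mul_add, hx, hy, add_zero]
    rw [Ideal.zero_eq_bot, eq_bot_iff]
    intro z hz
    simpa using key n z hz [] (by simp) (by simp)

lemma isSemisimpleModule_of_isTorsionBySet {A : Type*} [Ring A] [IsSemiprimaryRing A] {M : Type*}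
    [AddCommGroup M] [Module A M] (h : Module.IsTorsionBySet A M (Ring.jacobson A)) :
    IsSemisimpleModule A M := by
  let _ := h.module
  exact (h.semilinearMap.isSemisimpleModule_iff_of_bijective Function.bijective_id).2
    inferInstance

lemma isTorsionBySet_AmodJ (A : Type) [Ring A] :
    Module.IsTorsionBySet A (AmodJ A) (Ring.jacobson A) := by
  rw [← asIdeal_jrad]
  exact (Module.isTorsionBySet_quotient_iff _ _).2 fun x r hr ↦
    (jrad A).asIdeal.mul_mem_right x hr

section Semiprimary

variable {A : Type} [Ring A] [IsSemiprimaryRing A]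

open scoped DirectSum

lemma exists_section_directSum_AmodJ {M : Type} [AddCommGroup M] [Module A M]
    (hM : Module.IsTorsionBySet A M (Ring.jacobson A)) :
    ∃ (f : (⨁ _ : M, AmodJ A) →ₗ[A] M) (g : M →ₗ[A] ⨁ _ : M, AmodJ A),
      f ∘ₗ g = LinearMap.id := by
  classical
  have : IsSemisimpleModule A (⨁ _ : M, AmodJ A) :=
    isSemisimpleModule_of_isTorsionBySet fun x a ↦
      DFinsupp.ext fun i ↦ isTorsionBySet_AmodJ A (x := x i) (a := a)
  let φ (m : M) : AmodJ A →ₗ[A] M :=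
    Submodule.liftQ _ (LinearMap.toSpanSingleton A M m) fun a ha ↦
      hM (x := m) (a := ⟨a, asIdeal_jrad A ▸ ha⟩)
  let f : (⨁ _ : M, AmodJ A) →ₗ[A] M := DirectSum.toModule A M M φ
  have hf : Function.Surjective f := fun m ↦
    ⟨DirectSum.lof A M (fun _ ↦ AmodJ A) m (Submodule.Quotient.mk 1),
      (DirectSum.toModule_lof A m _).trans (one_smul A m)⟩
  obtain ⟨g, hg⟩ := IsSemisimpleModule.lifting_property f hf LinearMap.id
  exact ⟨f, g, hg⟩

lemma nonempty_retract_coproductCocone {M : ModuleCat.{0} A} [DecidableEq M]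
    (hM : Module.IsTorsionBySet A M (Ring.jacobson A)) :
    Nonempty (Retract M (ModuleCat.coproductCocone fun _ : M ↦ AmodJ A).pt) := by
  obtain ⟨f, g, h⟩ := exists_section_directSum_AmodJ hM
  exact ⟨⟨ModuleCat.ofHom g, ModuleCat.ofHom f, ModuleCat.hom_ext h⟩⟩

lemma nonempty_retract_productCone {M : ModuleCat.{0} A}
    (hM : Module.IsTorsionBySet A M (Ring.jacobson A)) :
    Nonempty (Retract M (ModuleCat.productCone fun _ : M ↦ AmodJ A).pt) := by
  have : IsSemisimpleModule A (M → AmodJ A) :=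
    isSemisimpleModule_of_isTorsionBySet fun x a ↦
      funext fun i ↦ isTorsionBySet_AmodJ A (x := x i) (a := a)
  obtain ⟨f, g, h⟩ := exists_section_directSum_AmodJ hM
  let ψ : M →ₗ[A] M → AmodJ A := LinearMap.pi fun m ↦ DirectSum.component A M _ m ∘ₗ g
  have hψ : Function.Injective ψ := fun x y hxy ↦ by
    have hg : g x = g y := DFinsupp.ext fun m ↦ congr_fun hxy m
    rw [← LinearMap.id_apply (R := A) x, ← h, LinearMap.comp_apply, hg, ← LinearMap.comp_apply, h,
      LinearMap.id_apply]
  obtain ⟨r, hr⟩ := IsSemisimpleModule.extension_property ψ hψ LinearMap.id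
  exact ⟨⟨ModuleCat.ofHom ψ, ModuleCat.ofHom r, ModuleCat.hom_ext hr⟩⟩

/-- Vanishing of `Ext^(n+1)(A/J, A/J)` implies vanishing of all `Ext^(n+1)`. -/
theorem subsingleton_ext_of_AmodJ {n : ℕ} [Subsingleton (Abelian.Ext (AmodJ A) (AmodJ A) (n + 1))]
    (M N : ModuleCat.{0} A) : Subsingleton (Abelian.Ext M N (n + 1)) := by
  classical
  have ses (M : ModuleCat.{0} A) (P : Submodule A M) :
      (Submodule.mkQ P).shortComplexKer.ShortExact :=
    LinearMap.shortExact_shortComplexKer (Submodule.mkQ_surjective P)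
  have torsion {M N : ModuleCat.{0} A} (hM : Module.IsTorsionBySet A M (Ring.jacobson A))
      (hN : Module.IsTorsionBySet A N (Ring.jacobson A)) :
      Subsingleton (Abelian.Ext M N (n + 1)) := by
    obtain ⟨rM⟩ := nonempty_retract_coproductCocone hM
    obtain ⟨rN⟩ := nonempty_retract_productCone hN
    have := subsingleton_of_forall_eq (α := Abelian.Ext
        (ModuleCat.coproductCocone fun _ : M ↦ AmodJ A).pt
        (ModuleCat.productCone fun _ : N ↦ AmodJ A).pt (n + 1)) 0 fun x ↦
      Abelian.Ext.eq_zero_of_cofan (ModuleCat.coproductCoconeIsColimit _) x fun _ ↦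
        Abelian.Ext.eq_zero_of_fan (ModuleCat.productConeIsLimit _) _ fun _ ↦
          Subsingleton.elim _ _
    exact Abelian.Ext.subsingleton_of_retract rM rN
  have right {M : ModuleCat.{0} A} (hM : Module.IsTorsionBySet A M (Ring.jacobson A))
      (N : ModuleCat.{0} A) : Subsingleton (Abelian.Ext M N (n + 1)) := by
    refine IsSemiprimaryRing.induction ℤ A N
      (P := fun N _ _ _ ↦ Subsingleton (Abelian.Ext M (ModuleCat.of A N) (n + 1)))
      (fun N _ _ _ _ _ hN ↦ torsion hM hN) fun N _ _ _ _ h₁ h₃ ↦ ?_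
    rw [← Submodule.ker_mkQ (Ring.jacobson A • (⊤ : Submodule A N))] at h₁
    exact @Abelian.Ext.subsingleton_X₂_right _ _ _ _ _ (ses (.of A N) _) _ _ h₁ h₃
  refine IsSemiprimaryRing.induction ℤ A M
    (P := fun M _ _ _ ↦ Subsingleton (Abelian.Ext (ModuleCat.of A M) N (n + 1)))
    (fun M _ _ _ _ _ hM ↦ right hM N) fun M _ _ _ _ h₁ h₃ ↦ ?_
  rw [← Submodule.ker_mkQ (Ring.jacobson A • (⊤ : Submodule A M))] at h₁
  exact @Abelian.Ext.subsingleton_X₂_left _ _ _ _ _ (ses (.of A M) _) _ _ h₁ h₃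

/-- `A/J` is a finite biproduct of simple modules. -/
lemma exists_bicone_AmodJ (A : Type) [Ring A] [IsSemiprimaryRing A] :
    ∃ (k : ℕ) (S : Fin k → ModuleCat.{0} A) (c : Limits.Bicone S),
      (∀ i, IsSimpleModule A (S i)) ∧ Nonempty c.IsBilimit ∧ c.pt = AmodJ A := by
  have : IsSemisimpleModule A (A ⧸ (jrad A).asIdeal) :=
    isSemisimpleModule_of_isTorsionBySet (isTorsionBySet_AmodJ A)
  obtain ⟨k, S, e, hS⟩ :=
    IsSemisimpleModule.exists_linearEquiv_fin_dfinsupp A (A ⧸ (jrad A).asIdeal)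
  let p (i : Fin k) : (A ⧸ (jrad A).asIdeal) →ₗ[A] S i :=
    DFinsupp.lapply (M := fun i ↦ S i) i ∘ₗ e.toLinearMap
  let s (i : Fin k) : S i →ₗ[A] A ⧸ (jrad A).asIdeal :=
    e.symm.toLinearMap ∘ₗ DFinsupp.lsingle (M := fun i ↦ S i) i
  have hps (i : Fin k) (x : S i) : p i (s i x) = x := by simp [p, s]
  have hps' {i j : Fin k} (h : i ≠ j) (x : S i) : p j (s i x) = 0 := by
    simp [p, s, DFinsupp.single_eq_of_ne h.symm]
  have hsp (x : A ⧸ (jrad A).asIdeal) : ∑ i, s i (p i x) = x := by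
    apply e.injective
    ext1 j
    rw [map_sum, DFinsupp.finsetSum_apply, Finset.sum_eq_single j]
    · simp [p, s]
    · intro i _ hi
      simp [p, s, DFinsupp.single_eq_of_ne hi.symm]
    · simp
  let c : Limits.Bicone fun i ↦ ModuleCat.of A (S i) :=
    { pt := AmodJ A
      π := fun i ↦ ModuleCat.ofHom (p i)
      ι := fun i ↦ ModuleCat.ofHom (s i)
      ι_π := fun i j ↦ by
        split_ifs with h
        · subst h
          exact ModuleCat.hom_ext (LinearMap.ext (hps i))
        · exact ModuleCat.hom_ext (LinearMap.ext (hps' h)) }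
  refine ⟨k, _, c, hS, ⟨Limits.isBilimitOfTotal c ?_⟩, rfl⟩
  refine ModuleCat.hom_ext (LinearMap.ext fun x ↦ ?_)
  rw [ModuleCat.hom_sum, LinearMap.sum_apply]
  exact hsp x

end Semiprimary

/-- If `A` is semiprimary, its Yoneda ring is generated in finite degrees and
`Ext^n(S, S) = 0` for all simple `S` and all `n ≥ m` for some `m > 0`,
then `A` has finite global dimension. -/
theorem stmt_3 (A : Type) [Ring A] (hA : IsSemiprimary A)
    (hgen : YonedaGeneratedInFiniteDegrees A)
    (hvan : ∃ m : ℕ, 0 < m ∧ ExtSelfVanishes A m) :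
    globalDim A ≠ ⊤ := by
  have := hA.isSemiprimaryRing_s3
  obtain ⟨s, hs⟩ := hgen
  obtain ⟨m, -, hm⟩ := hvan
  obtain ⟨k, S, c, hS, ⟨hc⟩, hpt⟩ := exists_bicone_AmodJ A
  rw [← hpt] at hs
  obtain ⟨N, hN⟩ := Abelian.Ext.exists_subsingleton_of_generated hc (fun p ↦ hm (S p) (hS p)) hs
  rw [hpt] at hN
  refine ne_top_of_le_ne_top (ENat.natCast_ne_top N) (iSup_le fun M ↦ sInf_le ⟨N, rfl, ?_⟩)
  rintro X (_ | n) hn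
  · simp at hn
  · have := hN (n + 1) hn
    exact subsingleton_ext_of_AmodJ M X

end
end
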